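/- arXiv:2012.02173 — 3 statements merged into one kernel-verified Lean document; each statement's English description precedes it below -/
import Mathlib

section
/- Let x_1, x_2, … be nonzero real numbers such that 1 + x_{j+1}/x_j ≠ 0 for all j, and for each j let Y_j = [[1, x_j],[1/x_j, 1]] and S_n = Y_n ⋯ Y_2 · Y_1. Then for every n ≥ 1, log‖S_n‖ = Σ_{j=1}^{n−1} log|1 + x_{j+1}/x_j| + log‖ [[1, x_1],[1/x_n, x_1/x_n]] ‖, where ‖·‖ is the Hilbert–Schmidt norm. -/
/-- The Hilbert–Schmidt (Frobenius) norm of a `2 × 2` real matrix. -/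
noncomputable def hsNorm (M : Matrix (Fin 2) (Fin 2) ℝ) : ℝ :=
  Real.sqrt (∑ i, ∑ j, (M i j) ^ 2)

/-- The partial products `S_n = Y_{n-1} ⋯ Y_1 ⋅ Y_0` of the singular matrices
`Y_j = [[1, x_j], [1/x_j, 1]]` (the sequence is indexed from `0` here, so `x 0`
plays the role of `x_1` in the paper). -/
noncomputable def matProd (x : ℕ → ℝ) : ℕ → Matrix (Fin 2) (Fin 2) ℝ
  | 0 => 1
  | n + 1 => !![1, x n; (x n)⁻¹, 1] * matProd x n

theorem hsNorm_smul (c : ℝ) (M : Matrix (Fin 2) (Fin 2) ℝ) :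
    hsNorm (c • M) = |c| * hsNorm M := by
  simp only [hsNorm, Matrix.smul_apply, smul_eq_mul, mul_pow, ← Finset.mul_sum]
  rw [Real.sqrt_mul (sq_nonneg c), Real.sqrt_sq_eq_abs]

theorem hsNorm_pos_of_apply_ne_zero {M : Matrix (Fin 2) (Fin 2) ℝ} {i j : Fin 2}
    (h : M i j ≠ 0) : 0 < hsNorm M := by
  refine Real.sqrt_pos.2 (Finset.sum_pos' (fun _ _ => by positivity) ⟨i, Finset.mem_univ i, ?_⟩)
  exact Finset.sum_pos' (fun _ _ => by positivity) ⟨j, Finset.mem_univ j, by positivity⟩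

/-- The product of the singular matrices is a scalar multiple of a matrix depending only on the
first and last terms of the sequence. -/
theorem matProd_succ_eq_smul (x : ℕ → ℝ) (hx : ∀ j, x j ≠ 0) (m : ℕ) :
    matProd x (m + 1) =
      (∏ j ∈ Finset.range m, (1 + x (j + 1) / x j)) •
        !![1, x 0; (x m)⁻¹, x 0 / x m] := by
  induction m with
  | zero => simp [matProd, hx 0]
  | succ m ih =>
    have h₀ := hx m
    have h₁ := hx (m + 1)
    rw [matProd, ih, Matrix.mul_smul, Finset.prod_range_succ, mul_smul]
    congr 1
    ext i j
    fin_cases i <;> fin_cases j <;> simp [Matrix.mul_apply, Fin.sum_univ_two] <;>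
      field_simp

/-- Equation (3.2): for nonzero reals `x_j` with `1 + x_{j+1}/x_j ≠ 0`, the logarithm
of the Hilbert–Schmidt norm of `S_n` decomposes as
`log‖S_n‖ = Σ_{j=1}^{n-1} log|1 + x_{j+1}/x_j| + log‖[[1, x_1],[1/x_n, x_1/x_n]]‖`
(with `0`-based indexing as in `matProd`). -/
theorem log_hsNorm_matProd
    (x : ℕ → ℝ) (hx : ∀ j, x j ≠ 0) (hsum : ∀ j, 1 + x (j + 1) / x j ≠ 0)
    (n : ℕ) (hn : 1 ≤ n) :
    Real.log (hsNorm (matProd x n)) =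
      (∑ j ∈ Finset.range (n - 1), Real.log |1 + x (j + 1) / x j|) +
        Real.log (hsNorm !![1, x 0; (x (n - 1))⁻¹, x 0 / x (n - 1)]) := by
  obtain ⟨m, rfl⟩ := Nat.exists_eq_add_of_le' hn
  have hpos : 0 < hsNorm !![1, x 0; (x m)⁻¹, x 0 / x m] :=
    hsNorm_pos_of_apply_ne_zero (i := 0) (j := 0) (by simp)
  rw [Nat.add_sub_cancel, matProd_succ_eq_smul x hx, hsNorm_smul, Finset.abs_prod,
    Real.log_mul (Finset.prod_ne_zero_iff.2 fun j _ => abs_ne_zero.2 (hsum j)) hpos.ne',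
    Real.log_prod fun j _ => abs_ne_zero.2 (hsum j)]
end

section
/- Let x_1, x_2 be i.i.d. random variables uniformly distributed on the interval (0, b] for some b > 0. Then E[ log|1 + x_2/x_1| ] = 2 log 2 − 1/2. -/
open MeasureTheory ProbabilityTheory

/-- The inner integral, by the fundamental theorem of calculus in the second variable. -/
lemma integral_log_one_add_div {x b : ℝ} (hx : 0 < x) (hb : 0 < b) :
    ∫ y in (0 : ℝ)..b, Real.log |1 + y / x| =
      (x + b) * Real.log (x + b) - (x + b) * Real.log x - b := by
  have hcongr : ∫ y in (0 : ℝ)..b, Real.log |1 + y / x| =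
      ∫ y in (0 : ℝ)..b, (Real.log (y + x) - Real.log x) := by
    refine intervalIntegral.integral_congr fun y hy => ?_
    rw [Set.uIcc_of_le hb.le] at hy
    have hyx : 0 < y + x := by linarith [hy.1]
    have : 1 + y / x = (y + x) / x := by field_simp; ring
    simp only [this, Real.log_abs]
    exact Real.log_div hyx.ne' hx.ne'
  rw [hcongr, intervalIntegral.integral_sub _ intervalIntegrable_const,
    intervalIntegral.integral_comp_add_right (fun u => Real.log u), integral_log,
    intervalIntegral.integral_const]
  · simp only [smul_eq_mul, zero_add, sub_zero, add_comm b x]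
    ring
  · simpa using (intervalIntegral.intervalIntegrable_log' (a := 0 + x) (b := b + x)).comp_add_right x

/-- The outer integral. -/
lemma integral_add_mul_log_sub {b : ℝ} (hb : 0 < b) :
    ∫ x in (0 : ℝ)..b, ((x + b) * Real.log (x + b) - (x + b) * Real.log x - b) =
      b ^ 2 * (2 * Real.log 2 - 1 / 2) := by
  let F : ℝ → ℝ := fun x => (x + b) / 2 * ((x + b) * Real.log (x + b)) - b * x / 2
    - x / 2 * (x * Real.log x) - b * (x * Real.log x)
  have hF : Continuous F := by
    have h₁ : Continuous fun x : ℝ => x * Real.log x := Real.continuous_mul_log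
    have h₂ : Continuous fun x : ℝ => (x + b) * Real.log (x + b) :=
      h₁.comp (continuous_id.add continuous_const)
    fun_prop
  have hderiv : ∀ x ∈ Set.Ioo (0 : ℝ) b, HasDerivAt F
      ((x + b) * Real.log (x + b) - (x + b) * Real.log x - b) x := by
    intro x hx
    have hx0 : x ≠ 0 := hx.1.ne'
    have hxb : x + b ≠ 0 := by linarith [hx.1]
    have h₁ := Real.hasDerivAt_mul_log hx0
    have h₂ := (Real.hasDerivAt_mul_log hxb).comp_add_const x b
    have h₃ := hasDerivAt_id x
    refine HasDerivAt.congr_deriv (((((h₃.add_const b).div_const 2).mul h₂).sub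
      ((h₃.const_mul b).div_const 2)).sub ((h₃.div_const 2).mul h₁) |>.sub (h₁.const_mul b)) ?_
    simp only [id]
    ring
  have hint : IntervalIntegrable
      (fun x => (x + b) * Real.log (x + b) - (x + b) * Real.log x - b) volume 0 b := by
    have h₂ : Continuous fun x : ℝ => (x + b) * Real.log (x + b) :=
      Real.continuous_mul_log.comp (continuous_id.add continuous_const)
    refine ((h₂.intervalIntegrable _ _).sub ?_).sub intervalIntegrable_const
    exact intervalIntegral.intervalIntegrable_log'.continuousOn_mul
      (by fun_prop)
  rw [intervalIntegral.integral_eq_sub_of_hasDerivAt_of_le hb.le hF.continuousOn hderiv hint]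
  have hlog : Real.log (b + b) = Real.log 2 + Real.log b := by
    rw [← two_mul, Real.log_mul two_ne_zero hb.ne']
  simp only [F, hlog]
  simp
  ring

/-- `log |1 + y / x|` lies between `0` and `log (2 b) - log x` when `0 < x, y ≤ b`. -/
lemma abs_log_abs_one_add_div_le {x y b : ℝ} (hx : x ∈ Set.Ioc 0 b) (hy : y ∈ Set.Ioc 0 b) :
    |(Real.log |1 + y / x|)| ≤ Real.log (2 * b) - Real.log x := by
  obtain ⟨hx0, hxb⟩ := hx
  obtain ⟨hy0, hyb⟩ := hy
  have hpos : 0 < y / x := div_pos hy0 hx0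
  rw [Real.log_abs, abs_of_nonneg (Real.log_nonneg (by linarith)),
    ← Real.log_div (by linarith) hx0.ne']
  refine Real.log_le_log (by linarith) ?_
  rw [le_div_iff₀ hx0, add_mul, div_mul_cancel₀ _ hx0.ne']
  linarith

/-- Example 5.2 (uniform, `a = 0`): for `x₁, x₂` i.i.d. uniform on `(0, b]`,
`E[log|1 + x₂/x₁|] = 2 log 2 - 1/2`. -/
theorem uniform_Ioc_lyapunov
    {Ω : Type*} [MeasurableSpace Ω] (P : Measure Ω) [IsProbabilityMeasure P]
    (b : ℝ) (hb : 0 < b)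
    (x₁ x₂ : Ω → ℝ) (hm₁ : Measurable x₁) (hm₂ : Measurable x₂)
    (hindep : IndepFun x₁ x₂ P)
    (hd₁ : Measure.map x₁ P = (ENNReal.ofReal b)⁻¹ • volume.restrict (Set.Ioc 0 b))
    (hd₂ : Measure.map x₂ P = Measure.map x₁ P) :
    ∫ ω, Real.log |1 + x₂ ω / x₁ ω| ∂P = 2 * Real.log 2 - 1 / 2 := by
  have hlaw := (indepFun_iff_map_prod_eq_prod_map_map hm₁.aemeasurable hm₂.aemeasurable).1 hindep
  rw [hd₂] at hlaw
  set ν := Measure.map x₁ P with hν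
  have : IsProbabilityMeasure ν := Measure.isProbabilityMeasure_map hm₁.aemeasurable
  have hmeas : Measurable fun p : ℝ × ℝ => Real.log |1 + p.2 / p.1| := by fun_prop
  have hsupp : ∀ᵐ x ∂ν, x ∈ Set.Ioc 0 b := by
    rw [hd₁]
    exact Measure.ae_smul_measure (ae_restrict_mem measurableSet_Ioc) _
  have hscale (g : ℝ → ℝ) : ∫ x, g x ∂ν = b⁻¹ * ∫ x in (0 : ℝ)..b, g x := by
    rw [hd₁, integral_smul_measure, intervalIntegral.integral_of_le hb.le, ENNReal.toReal_inv,
      ENNReal.toReal_ofReal hb.le, smul_eq_mul]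
  have hlog : Integrable Real.log ν := by
    rw [hd₁]
    refine Integrable.smul_measure ?_ (by simpa using hb)
    exact (intervalIntegrable_iff_integrableOn_Ioc_of_le hb.le).1
      intervalIntegral.intervalIntegrable_log'
  have hint : Integrable (fun p : ℝ × ℝ => Real.log |1 + p.2 / p.1|) (ν.prod ν) := by
    refine (((integrable_const (Real.log (2 * b))).sub hlog).comp_fst ν).mono'
      hmeas.aestronglyMeasurable ?_
    filter_upwards [Measure.quasiMeasurePreserving_fst.ae hsupp,
      Measure.quasiMeasurePreserving_snd.ae hsupp] with p h₁ h₂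
    exact abs_log_abs_one_add_div_le h₁ h₂
  calc ∫ ω, Real.log |1 + x₂ ω / x₁ ω| ∂P
      = ∫ p : ℝ × ℝ, Real.log |1 + p.2 / p.1| ∂(ν.prod ν) := by
        rw [← hlaw, integral_map (hm₁.prodMk hm₂).aemeasurable hmeas.aestronglyMeasurable]
    _ = ∫ x, ∫ y, Real.log |1 + y / x| ∂ν ∂ν := integral_prod _ hint
    _ = ∫ x, b⁻¹ * ((x + b) * Real.log (x + b) - (x + b) * Real.log x - b) ∂ν := by
        refine integral_congr_ae ?_
        filter_upwards [hsupp] with x hx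
        rw [hscale, integral_log_one_add_div hx.1 hb]
    _ = 2 * Real.log 2 - 1 / 2 := by
        rw [integral_const_mul, hscale, integral_add_mul_log_sub hb]
        field_simp
end

section
/- Let x_1, x_2 be i.i.d. random variables uniformly distributed on the symmetric interval [−b, b] for some b > 0 (so that x_j ≠ 0 almost surely). Then E[ log|1 + x_2/x_1| ] = log 2 − 1/2. -/
open MeasureTheory ProbabilityTheory

theorem integral_mul_log (a b : ℝ) :
    ∫ x in a..b, x * Real.log x =
      (b ^ 2 / 2 * Real.log b - b ^ 2 / 4) - (a ^ 2 / 2 * Real.log a - a ^ 2 / 4) := by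
  refine MeasureTheory.integral_eq_of_hasDerivAt_off_countable
    (fun x : ℝ => x ^ 2 / 2 * Real.log x - x ^ 2 / 4) _ (Set.countable_singleton (0 : ℝ)) ?_ ?_
    (Real.continuous_mul_log.intervalIntegrable _ _)
  · have h : (fun x : ℝ => x ^ 2 / 2 * Real.log x - x ^ 2 / 4) =
        fun x => x / 2 * (x * Real.log x) - x ^ 2 / 4 := by
      ext x; ring
    rw [h]
    have := Real.continuous_mul_log
    fun_prop
  · rintro x ⟨-, hx⟩
    have hx : x ≠ 0 := hx
    have h := (((hasDerivAt_pow 2 x).div_const 2).mul (Real.hasDerivAt_log hx)).sub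
      ((hasDerivAt_pow 2 x).div_const 4)
    refine h.congr_deriv ?_
    field_simp
    ring

theorem integrableOn_log_Icc (a b : ℝ) : IntegrableOn Real.log (Set.Icc a b) := by
  rcases le_or_gt a b with h | h
  · exact (intervalIntegrable_iff_integrableOn_Icc_of_le h).1
      intervalIntegral.intervalIntegrable_log'
  · simp [Set.Icc_eq_empty_of_lt h]

theorem integrable_log_add_prod_restrict_Icc (a b c d : ℝ) :
    Integrable (fun p : ℝ × ℝ => Real.log (p.1 + p.2))
      ((volume.restrict (Set.Icc a b)).prod (volume.restrict (Set.Icc c d))) := by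
  have h1 : Integrable ((Set.Icc a b).indicator fun _ => (1 : ℝ)) :=
    (integrable_indicator_iff measurableSet_Icc).2 (integrableOn_const (by simp))
  have h2 : Integrable ((Set.Icc (a + c) (b + d)).indicator Real.log) :=
    (integrable_indicator_iff measurableSet_Icc).2 (integrableOn_log_Icc _ _)
  have h3 := (measurePreserving_prod_add (volume : Measure ℝ) volume).integrable_comp_of_integrable
    (h1.mul_prod h2)
  rw [Measure.prod_restrict]
  refine h3.integrableOn.congr_fun ?_ (measurableSet_Icc.prod measurableSet_Icc)
  rintro ⟨x, y⟩ ⟨hx, hy⟩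
  have hxy : x + y ∈ Set.Icc (a + c) (b + d) := ⟨add_le_add hx.1 hy.1, add_le_add hx.2 hy.2⟩
  simp only at hx
  simp [Set.indicator_of_mem hx, Set.indicator_of_mem hxy]

theorem setIntegral_Icc_log_symm {b : ℝ} (hb : 0 < b) :
    ∫ x in Set.Icc (-b) b, Real.log x = 2 * b * (Real.log b - 1) := by
  rw [integral_Icc_eq_integral_Ioc, ← intervalIntegral.integral_of_le (by linarith), integral_log,
    Real.log_neg_eq_log]
  ring

theorem setIntegral_Icc_log_add_symm {b : ℝ} (hb : 0 < b) :
    ∫ x in Set.Icc (-b) b, ∫ y in Set.Icc (-b) b, Real.log (x + y) =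
      (2 * b) ^ 2 * (Real.log (2 * b) - 3 / 2) := by
  have hinner (x : ℝ) : ∫ y in Set.Icc (-b) b, Real.log (x + y) =
      (x + b) * Real.log (x + b) - (x - b) * Real.log (x - b) - 2 * b := by
    rw [integral_Icc_eq_integral_Ioc, ← intervalIntegral.integral_of_le (by linarith),
      intervalIntegral.integral_comp_add_left Real.log, integral_log]
    ring_nf
  have hadd : Continuous fun x : ℝ => (x + b) * Real.log (x + b) :=
    Real.continuous_mul_log.comp (continuous_id.add continuous_const)
  have hsub : Continuous fun x : ℝ => (x - b) * Real.log (x - b) :=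
    Real.continuous_mul_log.comp (continuous_id.sub continuous_const)
  simp_rw [hinner]
  rw [integral_Icc_eq_integral_Ioc, ← intervalIntegral.integral_of_le (by linarith),
    intervalIntegral.integral_sub (Continuous.intervalIntegrable (by fun_prop) _ _) (by simp),
    intervalIntegral.integral_sub (hadd.intervalIntegrable _ _) (hsub.intervalIntegrable _ _),
    intervalIntegral.integral_comp_add_right fun u => u * Real.log u,
    intervalIntegral.integral_comp_sub_right fun u => u * Real.log u,
    integral_mul_log, integral_mul_log, intervalIntegral.integral_const]
  have h : -b - b = -(2 * b) := by ring
  have h' : b + b = 2 * b := by ring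
  simp only [h, h', Real.log_neg_eq_log, neg_add_cancel, sub_self, smul_eq_mul, sub_neg_eq_add]
  ring

theorem ae_log_abs_one_add_div (μ ν : Measure ℝ) [SFinite μ] [SFinite ν] (hμ : μ ≪ volume)
    (hν : ν ≪ volume) :
    ∀ᵐ p : ℝ × ℝ ∂μ.prod ν,
      Real.log |1 + p.2 / p.1| = Real.log (p.1 + p.2) - Real.log p.1 := by
  have hfst : ∀ᵐ p : ℝ × ℝ ∂(volume : Measure ℝ).prod volume, p.1 ≠ 0 :=
    Measure.quasiMeasurePreserving_fst.ae (Measure.ae_ne volume (0 : ℝ))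
  have hsum : ∀ᵐ p : ℝ × ℝ ∂(volume : Measure ℝ).prod volume, p.1 + p.2 ≠ 0 :=
    (quasiMeasurePreserving_add volume volume).ae (Measure.ae_ne volume (0 : ℝ))
  filter_upwards [(hμ.prod hν).ae_le hfst, (hμ.prod hν).ae_le hsum] with p hp hp'
  rw [Real.log_abs, ← Real.log_div hp' hp]
  congr 1
  field_simp

/-- Example 5.2 (uniform, `a = b`): for `x₁, x₂` i.i.d. uniform on `[-b, b]`
(so `x_j ≠ 0` almost surely), `E[log|1 + x₂/x₁|] = log 2 - 1/2`. -/
theorem uniform_symmetric_lyapunov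
    {Ω : Type*} [MeasurableSpace Ω] (P : Measure Ω) [IsProbabilityMeasure P]
    (b : ℝ) (hb : 0 < b)
    (x₁ x₂ : Ω → ℝ) (hm₁ : Measurable x₁) (hm₂ : Measurable x₂)
    (hindep : IndepFun x₁ x₂ P)
    (hd₁ : Measure.map x₁ P =
      (ENNReal.ofReal (2 * b))⁻¹ • volume.restrict (Set.Icc (-b) b))
    (hd₂ : Measure.map x₂ P = Measure.map x₁ P) :
    ∫ ω, Real.log |1 + x₂ ω / x₁ ω| ∂P = Real.log 2 - 1 / 2 := by
  have hc : (ENNReal.ofReal (2 * b))⁻¹ ≠ ⊤ := by simpa using hb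
  have hν : IsProbabilityMeasure (Measure.map x₁ P) :=
    Measure.isProbabilityMeasure_map hm₁.aemeasurable
  have hmap := (indepFun_iff_map_prod_eq_prod_map_map hm₁.aemeasurable hm₂.aemeasurable).1 hindep
  rw [hd₂] at hmap
  have hac : Measure.map x₁ P ≪ volume := by
    rw [hd₁]
    exact (Measure.absolutelyContinuous_of_le Measure.restrict_le_self).smul_left _
  have hint_log : Integrable Real.log (Measure.map x₁ P) := by
    rw [hd₁]
    exact (integrableOn_log_Icc _ _).smul_measure hc
  have hint_add : Integrable (fun p : ℝ × ℝ => Real.log (p.1 + p.2))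
      ((Measure.map x₁ P).prod (Measure.map x₁ P)) := by
    rw [hd₁, Measure.prod_smul_left, Measure.prod_smul_right]
    exact ((integrable_log_add_prod_restrict_Icc _ _ _ _).smul_measure hc).smul_measure hc
  have hmeas : Measurable fun p : ℝ × ℝ => Real.log |1 + p.2 / p.1| := by fun_prop
  calc ∫ ω, Real.log |1 + x₂ ω / x₁ ω| ∂P
      = ∫ p : ℝ × ℝ, Real.log |1 + p.2 / p.1|
          ∂(Measure.map x₁ P).prod (Measure.map x₁ P) := by
        rw [← hmap, integral_map (hm₁.prodMk hm₂).aemeasurable hmeas.aestronglyMeasurable]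
    _ = ∫ p : ℝ × ℝ, (Real.log (p.1 + p.2) - Real.log p.1)
          ∂(Measure.map x₁ P).prod (Measure.map x₁ P) :=
        integral_congr_ae (ae_log_abs_one_add_div _ _ hac hac)
    _ = (∫ x, ∫ y, Real.log (x + y) ∂Measure.map x₁ P ∂Measure.map x₁ P) -
          ∫ x, Real.log x ∂Measure.map x₁ P := by
        rw [integral_sub hint_add (hint_log.comp_fst _), integral_prod _ hint_add,
          integral_fun_fst Real.log, probReal_univ, one_smul]
    _ = Real.log 2 - 1 / 2 := by
        simp only [hd₁, integral_smul_measure, smul_eq_mul, integral_const_mul, setIntegral_Icc_log_symm hb,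
          setIntegral_Icc_log_add_symm hb, ENNReal.toReal_inv,
          ENNReal.toReal_ofReal (show 0 ≤ 2 * b by positivity)]
        rw [Real.log_mul two_ne_zero hb.ne']
        field_simp
        ring
end
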